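/- Under Assumption H with β₁ = 0, β₃ − β₂T₂/T₁ ≠ 0 and α₁ ≠ γ₁, there exists ε₂ ∈ (0,ε₁] such that for every ε ∈ (0,ε₂) the set K_ε := { (x,y) ∈ ℝ² : there is μ ∈ [μ∧(ε), μ∨(ε)] with y = S(μ,ε)/2 and 4x² ≤ D(μ,ε) } is a compact convex subset of ℝ² with nonempty interior, and its topological boundary equals the eigenvalue curve { (Re λ, Im λ) : λ is an eigenvalue of L(μ,ε) for some μ ∈ [μ∧(ε), μ∨(ε)] }. -/

import Mathlib

open Matrix Set

noncomputable def Jmat : Matrix (Fin 2) (Fin 2) ℂ := !![-Complex.I, 0; 0, Complex.I]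

noncomputable def Bmat (a b c : ℝ) : Matrix (Fin 2) (Fin 2) ℂ :=
  !![(a : ℂ), Complex.I * (b : ℂ); -Complex.I * (b : ℂ), (c : ℂ)]

/-- The 2×2 Hamiltonian and reversible matrix `L = J ⬝ B`. -/
noncomputable def Lmat (a b c : ℝ) : Matrix (Fin 2) (Fin 2) ℂ := Jmat * Bmat a b c

/-- `l` is an eigenvalue of `M`, i.e. a root of its characteristic polynomial. -/
def IsEig (M : Matrix (Fin 2) (Fin 2) ℂ) (l : ℂ) : Prop := (Matrix.charpoly M).IsRoot l

/-- Assumption H: expansions of the real analytic entries `α, β, γ` of the matrix `B(μ,ε)`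
around `(μ̄, 0)`, with `T₁ = α₁ + γ₁ > 0`. -/
structure AssumptionH (μb ωs δ₀ ε₀ : ℝ) (α β γ : ℝ → ℝ → ℝ)
    (α₁ α₂ β₁ β₂ β₃ γ₁ γ₂ : ℝ) : Prop where
  hδ₀ : 0 < δ₀
  hε₀ : 0 < ε₀
  hα_an : AnalyticOnNhd ℝ (fun p : ℝ × ℝ => α p.1 p.2)
    (Ioo (μb - δ₀) (μb + δ₀) ×ˢ Ioo (-ε₀) ε₀)
  hβ_an : AnalyticOnNhd ℝ (fun p : ℝ × ℝ => β p.1 p.2)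
    (Ioo (μb - δ₀) (μb + δ₀) ×ˢ Ioo (-ε₀) ε₀)
  hγ_an : AnalyticOnNhd ℝ (fun p : ℝ × ℝ => γ p.1 p.2)
    (Ioo (μb - δ₀) (μb + δ₀) ×ˢ Ioo (-ε₀) ε₀)
  hT₁ : 0 < α₁ + γ₁
  hexp : ∃ α₀ γ₀ : ℝ → ℝ, ∃ d ∈ Ioc (0 : ℝ) δ₀, ∃ e ∈ Ioc (0 : ℝ) ε₀, ∃ C : ℝ, 0 < C ∧
    AnalyticOnNhd ℝ α₀ (Ioo (-d) d) ∧ AnalyticOnNhd ℝ γ₀ (Ioo (-d) d) ∧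
    ∀ δ ε : ℝ, |δ| < d → |ε| < e →
      |α (μb + δ) ε - (-(α₀ δ) + α₂ * ε ^ 2)| ≤ C * (|ε| ^ 3 + |δ| * ε ^ 2 + δ ^ 2 * |ε|) ∧
      |β (μb + δ) ε - (β₁ * ε ^ 2 + β₂ * δ * ε ^ 2 + β₃ * ε ^ 4)| ≤
        C * (|ε| ^ 5 + |δ| * |ε| ^ 3 + δ ^ 2 * ε ^ 2 + |δ| ^ 3 * |ε|) ∧
      |γ (μb + δ) ε - (γ₀ δ + γ₂ * ε ^ 2)| ≤ C * (|ε| ^ 3 + |δ| * ε ^ 2 + δ ^ 2 * |ε|) ∧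
      |α₀ δ - (ωs - α₁ * δ)| ≤ C * δ ^ 2 ∧
      |γ₀ δ - (ωs + γ₁ * δ)| ≤ C * δ ^ 2

/-- The graphs of the real analytic functions `μ₀, μ₊, μ₋` are exactly the zero sets of
`T = α + γ`, `d₊ = T + 2β`, `d₋ = T - 2β` in `(μ̄-δ₀,μ̄+δ₀) × (-ε₁,ε₁)`, with the sign
of these functions positive above the respective graph and negative below it. -/
structure ZeroCurves (μb δ₀ : ℝ) (α β γ : ℝ → ℝ → ℝ) (ε₁ : ℝ)
    (μ₀ μp μm : ℝ → ℝ) : Prop where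
  hμ₀_an : AnalyticOnNhd ℝ μ₀ (Ioo (-ε₁) ε₁)
  hμp_an : AnalyticOnNhd ℝ μp (Ioo (-ε₁) ε₁)
  hμm_an : AnalyticOnNhd ℝ μm (Ioo (-ε₁) ε₁)
  hmaps₀ : ∀ ε ∈ Ioo (-ε₁) ε₁, μ₀ ε ∈ Ioo (μb - δ₀) (μb + δ₀)
  hmapsp : ∀ ε ∈ Ioo (-ε₁) ε₁, μp ε ∈ Ioo (μb - δ₀) (μb + δ₀)
  hmapsm : ∀ ε ∈ Ioo (-ε₁) ε₁, μm ε ∈ Ioo (μb - δ₀) (μb + δ₀)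
  hT : ∀ μ ∈ Ioo (μb - δ₀) (μb + δ₀), ∀ ε ∈ Ioo (-ε₁) ε₁,
    (α μ ε + γ μ ε = 0 ↔ μ = μ₀ ε) ∧
    (μ₀ ε < μ → 0 < α μ ε + γ μ ε) ∧ (μ < μ₀ ε → α μ ε + γ μ ε < 0)
  hdp : ∀ μ ∈ Ioo (μb - δ₀) (μb + δ₀), ∀ ε ∈ Ioo (-ε₁) ε₁,
    (α μ ε + γ μ ε + 2 * β μ ε = 0 ↔ μ = μp ε) ∧
    (μp ε < μ → 0 < α μ ε + γ μ ε + 2 * β μ ε) ∧ (μ < μp ε → α μ ε + γ μ ε + 2 * β μ ε < 0)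
  hdm : ∀ μ ∈ Ioo (μb - δ₀) (μb + δ₀), ∀ ε ∈ Ioo (-ε₁) ε₁,
    (α μ ε + γ μ ε - 2 * β μ ε = 0 ↔ μ = μm ε) ∧
    (μm ε < μ → 0 < α μ ε + γ μ ε - 2 * β μ ε) ∧ (μ < μm ε → α μ ε + γ μ ε - 2 * β μ ε < 0)

lemma isEig_Lmat_iff (a b c : ℝ) (h : 0 ≤ 4 * b ^ 2 - (a + c) ^ 2) (l : ℂ) :
    IsEig (Lmat a b c) l ↔
      l.im = (c - a) / 2 ∧ 4 * l.re ^ 2 = 4 * b ^ 2 - (a + c) ^ 2 := by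
  have hchar : IsEig (Lmat a b c) l ↔
      l ^ 2 - Complex.I * (c - a) * l + (a * c - b ^ 2) = 0 := by
    have htr : (Lmat a b c).trace = Complex.I * (c - a) := by
      simp [Lmat, Jmat, Bmat, Matrix.trace_fin_two]
      ring
    have hdet : (Lmat a b c).det = a * c - b ^ 2 := by
      simp only [Lmat, Jmat, Bmat, Matrix.det_mul, Matrix.det_fin_two_of]
      linear_combination (- (a : ℂ) * c - Complex.I ^ 2 * b ^ 2 + b ^ 2) * Complex.I_sq
    rw [IsEig, Polynomial.IsRoot, Matrix.charpoly_fin_two, htr, hdet]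
    simp
  rw [hchar, Complex.ext_iff]
  have hre : (l ^ 2 - Complex.I * (c - a) * l + (a * c - b ^ 2)).re =
      l.re ^ 2 - l.im ^ 2 + (c - a) * l.im + (a * c - b ^ 2) := by
    simp [pow_two]
  have him : (l ^ 2 - Complex.I * (c - a) * l + (a * c - b ^ 2)).im =
      2 * l.re * l.im - (c - a) * l.re := by
    simp [pow_two]
    ring
  rw [hre, him, Complex.zero_re, Complex.zero_im]
  constructor
  · rintro ⟨h1, h2⟩
    have hy : l.im = (c - a) / 2 := by
      rcases eq_or_ne l.re 0 with hx | hx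
      · rw [hx] at h1
        have : (l.im - (c - a) / 2) ^ 2 = 0 :=
          le_antisymm (by nlinarith) (sq_nonneg _)
        linarith [pow_eq_zero_iff (two_ne_zero) |>.1 this]
      · have : 2 * l.im - (c - a) = 0 := by
          apply mul_left_cancel₀ hx
          linarith
        linarith
    refine ⟨hy, ?_⟩
    rw [hy] at h1
    linarith
  · rintro ⟨h1, h2⟩
    rw [h1]
    constructor <;> linarith

/-- A second derivative criterion for the concavity of `D ∘ s⁻¹` on the image of `[a, b]` under the
monotone map `s`. -/
lemma exists_concave_of_ratio {a b : ℝ} {s s' s'' D D' D'' : ℝ → ℝ}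
    (hs : ∀ x ∈ Icc a b, HasDerivAt s (s' x) x) (hs' : ∀ x ∈ Icc a b, HasDerivAt s' (s'' x) x)
    (hD : ∀ x ∈ Icc a b, HasDerivAt D (D' x) x) (hD' : ∀ x ∈ Icc a b, HasDerivAt D' (D'' x) x)
    (hne : ∀ x ∈ Icc a b, s' x ≠ 0)
    (hconc : ∀ c ∈ Icc a b, ∀ x ∈ Icc a b, D'' x - D' c / s' c * s'' x ≤ 0)
    {u v t₁ t₂ : ℝ} (hu : u ∈ Icc a b) (hv : v ∈ Icc a b) (huv : u < v)
    (ht₁ : 0 ≤ t₁) (ht₂ : 0 ≤ t₂) (ht : t₁ + t₂ = 1) :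
    ∃ x ∈ Icc a b, s x = t₁ * s u + t₂ * s v ∧ t₁ * D u + t₂ * D v ≤ D x := by
  have hsub : Icc u v ⊆ Icc a b := Icc_subset_Icc hu.1 hv.2
  have hsc : ContinuousOn s (Icc u v) := fun x hx =>
    (hs x (hsub hx)).continuousAt.continuousWithinAt
  have hDc : ContinuousOn D (Icc u v) := fun x hx =>
    (hD x (hsub hx)).continuousAt.continuousWithinAt
  obtain ⟨c, hc, hratio⟩ := exists_ratio_hasDerivAt_eq_ratio_slope D D' huv hDc
    (fun x hx => hD x (hsub (Ioo_subset_Icc_self hx))) s s' hsc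
    (fun x hx => hs x (hsub (Ioo_subset_Icc_self hx)))
  have hcab := hsub (Ioo_subset_Icc_self hc)
  obtain ⟨x, hx, hxs⟩ : ∃ x ∈ Icc u v, s x = t₁ * s u + t₂ * s v := by
    have hmem : t₁ * s u + t₂ * s v ∈ uIcc (s u) (s v) := by
      rw [← segment_eq_uIcc]
      exact ⟨t₁, t₂, ht₁, ht₂, ht, rfl⟩
    have := intermediate_value_uIcc (a := u) (b := v) (by rwa [uIcc_of_le huv.le]) hmem
    rwa [uIcc_of_le huv.le] at this
  refine ⟨x, hsub hx, hxs, ?_⟩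
  set p := D' c / s' c with hp
  have hpc : D v - D u = p * (s v - s u) := by
    rw [hp]
    field_simp [hne c hcab]
    linarith
  have hcv : ConcaveOn ℝ (Icc u v) (fun x => D x - p * s x) := by
    refine concaveOn_of_hasDerivWithinAt2_nonpos (convex_Icc u v)
      (hDc.sub (continuousOn_const.mul hsc)) (f' := fun x => D' x - p * s' x)
      (f'' := fun x => D'' x - p * s'' x) ?_ ?_ ?_
    · intro y hy
      have hy' := hsub (interior_subset hy)
      exact ((hD y hy').sub ((hs y hy').const_mul p)).hasDerivWithinAt
    · intro y hy
      have hy' := hsub (interior_subset hy)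
      exact ((hD' y hy').sub ((hs' y hy').const_mul p)).hasDerivWithinAt
    · intro y hy
      exact hconc c hcab y (hsub (interior_subset hy))
  have hmin := hcv.min_le_of_mem_Icc (left_mem_Icc.2 huv.le) (right_mem_Icc.2 huv.le) hx
  have heq : D u - p * s u = D v - p * s v := by linarith
  rw [← heq, min_self, hxs] at hmin
  have h1 : t₁ = 1 - t₂ := by linarith
  have h2 : D v = D u + p * (s v - s u) := by linarith
  rw [h1] at hmin ⊢
  rw [h2]
  linarith

/-- The region bounded by the curves `μ ↦ (± √(D μ) / 2, s μ)` is a convex body whose frontier is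
the union of the two curves. -/
lemma convexBody_of_ratio {a b : ℝ} (hab : a < b) {s s' s'' D D' D'' : ℝ → ℝ}
    (hs : ∀ x ∈ Icc a b, HasStrictDerivAt s (s' x) x)
    (hs' : ∀ x ∈ Icc a b, HasDerivAt s' (s'' x) x)
    (hD : ∀ x ∈ Icc a b, HasDerivAt D (D' x) x) (hD' : ∀ x ∈ Icc a b, HasDerivAt D' (D'' x) x)
    (hne : ∀ x ∈ Icc a b, s' x ≠ 0)
    (hconc : ∀ c ∈ Icc a b, ∀ x ∈ Icc a b, D'' x - D' c / s' c * s'' x ≤ 0)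
    (ha : D a = 0) (hb : D b = 0) (hpos : ∀ x ∈ Ioo a b, 0 < D x) :
    IsCompact {p : ℝ × ℝ | ∃ x ∈ Icc a b, p.2 = s x ∧ 4 * p.1 ^ 2 ≤ D x} ∧
    Convex ℝ {p : ℝ × ℝ | ∃ x ∈ Icc a b, p.2 = s x ∧ 4 * p.1 ^ 2 ≤ D x} ∧
    (interior {p : ℝ × ℝ | ∃ x ∈ Icc a b, p.2 = s x ∧ 4 * p.1 ^ 2 ≤ D x}).Nonempty ∧
    frontier {p : ℝ × ℝ | ∃ x ∈ Icc a b, p.2 = s x ∧ 4 * p.1 ^ 2 ≤ D x} =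
      {p : ℝ × ℝ | ∃ x ∈ Icc a b, p.2 = s x ∧ 4 * p.1 ^ 2 = D x} := by
  set K := {p : ℝ × ℝ | ∃ x ∈ Icc a b, p.2 = s x ∧ 4 * p.1 ^ 2 ≤ D x} with hK
  have hsd : ∀ x ∈ Icc a b, HasDerivAt s (s' x) x := fun x hx => (hs x hx).hasDerivAt
  have hsc : ContinuousOn s (Icc a b) := fun x hx =>
    (hsd x hx).continuousAt.continuousWithinAt
  have hDc : ContinuousOn D (Icc a b) := fun x hx =>
    (hD x hx).continuousAt.continuousWithinAt
  have hinj : ∀ u ∈ Icc a b, ∀ v ∈ Icc a b, u < v → s u ≠ s v := by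
    intro u hu v hv huv h
    have hsub : Icc u v ⊆ Icc a b := Icc_subset_Icc hu.1 hv.2
    obtain ⟨c, hc, h0⟩ := exists_hasDerivAt_eq_zero huv (hsc.mono hsub) h
      (fun x hx => hsd x (hsub (Ioo_subset_Icc_self hx)))
    exact hne c (hsub (Ioo_subset_Icc_self hc)) h0
  have hinjOn : InjOn s (Icc a b) := by
    intro u hu v hv h
    rcases lt_trichotomy u v with huv | huv | huv
    · exact absurd h (hinj u hu v hv huv)
    · exact huv
    · exact absurd h.symm (hinj v hv u hu huv)
  have hcomp : IsCompact K := by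
    obtain ⟨M, hM⟩ := (isCompact_Icc.image_of_continuousOn hDc).bddAbove
    have hM' : ∀ x ∈ Icc a b, D x ≤ M := fun x hx => hM ⟨x, hx, rfl⟩
    have hset : IsCompact {q : ℝ × ℝ | q ∈ Icc (-(M + 1)) (M + 1) ×ˢ Icc a b ∧
        4 * q.1 ^ 2 - D q.2 ∈ Iic 0} := by
      have hcl := ContinuousOn.preimage_isClosed_of_isClosed
        (s := Icc (-(M + 1)) (M + 1) ×ˢ Icc a b) (t := Iic (0 : ℝ))
        (f := fun q : ℝ × ℝ => 4 * q.1 ^ 2 - D q.2)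
        (by
          refine ContinuousOn.sub (by fun_prop) ?_
          exact hDc.comp continuousOn_snd (fun q hq => hq.2))
        (isClosed_Icc.prod isClosed_Icc) isClosed_Iic
      exact (isCompact_Icc.prod isCompact_Icc).of_isClosed_subset hcl inter_subset_left
    have himg := hset.image_of_continuousOn (f := fun q : ℝ × ℝ => (q.1, s q.2))
      (continuousOn_fst.prodMk (hsc.comp continuousOn_snd (fun q hq => hq.1.2)))
    convert himg using 1
    ext ⟨x, y⟩
    constructor
    · rintro ⟨m, hm, hy, hx⟩
      have hMm := hM' m hm
      simp only at hx hy
      refine ⟨(x, m), ⟨⟨⟨?_, ?_⟩, hm⟩, ?_⟩, by simp [hy]⟩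
      · dsimp only
        nlinarith [sq_nonneg (2 * x + 1)]
      · dsimp only
        nlinarith [sq_nonneg (2 * x - 1)]
      · simpa using hx
    · rintro ⟨⟨x', m⟩, ⟨⟨-, hm⟩, h⟩, heq⟩
      simp only [Prod.mk.injEq] at heq
      refine ⟨m, hm, heq.2.symm, ?_⟩
      simpa [← heq.1] using h
  have hconv : Convex ℝ K := by
    have key : ∀ u ∈ Icc a b, ∀ v ∈ Icc a b, ∀ t₁ t₂ : ℝ, 0 ≤ t₁ → 0 ≤ t₂ → t₁ + t₂ = 1 →
        ∃ x ∈ Icc a b, s x = t₁ * s u + t₂ * s v ∧ t₁ * D u + t₂ * D v ≤ D x := by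
      intro u hu v hv t₁ t₂ h₁ h₂ h
      rcases lt_trichotomy u v with huv | rfl | huv
      · exact exists_concave_of_ratio hsd hs' hD hD' hne hconc hu hv huv h₁ h₂ h
      · exact ⟨u, hu, by rw [← add_mul, h, one_mul], by rw [← add_mul, h, one_mul]⟩
      · obtain ⟨x, hx, e, f⟩ := exists_concave_of_ratio hsd hs' hD hD' hne hconc hv hu huv h₂ h₁
          (by rwa [add_comm])
        exact ⟨x, hx, by rw [e, add_comm], by rwa [add_comm]⟩
    rintro ⟨x₁, y₁⟩ ⟨u, hu, hy₁, hx₁⟩ ⟨x₂, y₂⟩ ⟨v, hv, hy₂, hx₂⟩ t₁ t₂ h₁ h₂ h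
    obtain ⟨x, hx, e, f⟩ := key u hu v hv t₁ t₂ h₁ h₂ h
    simp only at hy₁ hx₁ hy₂ hx₂
    refine ⟨x, hx, by simp [e, hy₁, hy₂], le_trans ?_ f⟩
    have hsq : (t₁ * x₁ + t₂ * x₂) ^ 2 ≤ t₁ * x₁ ^ 2 + t₂ * x₂ ^ 2 := by
      have h1 : t₁ = 1 - t₂ := by linarith
      have := mul_nonneg (mul_nonneg h₁ h₂) (sq_nonneg (x₁ - x₂))
      rw [h1] at this ⊢
      nlinarith
    have e1 := mul_le_mul_of_nonneg_left hx₁ h₁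
    have e2 := mul_le_mul_of_nonneg_left hx₂ h₂
    simp only [Prod.smul_mk, Prod.mk_add_mk, smul_eq_mul]
    linarith
  have hint : ∀ x, ∀ m ∈ Ioo a b, 4 * x ^ 2 < D m → (x, s m) ∈ interior K := by
    intro x m hm hlt
    have hm' := Ioo_subset_Icc_self hm
    rw [mem_interior_iff_mem_nhds, nhds_prod_eq, ← (hs m hm').map_nhds_eq (hne m hm')]
    have hev : ∀ᶠ q : ℝ × ℝ in nhds x ×ˢ nhds m, q.2 ∈ Ioo a b ∧ 4 * q.1 ^ 2 < D q.2 := by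
      rw [← nhds_prod_eq]
      have hcD : ContinuousAt (fun q : ℝ × ℝ => D q.2) (x, m) :=
        ContinuousAt.comp (x := (x, m)) (f := Prod.snd) (hD m hm').continuousAt continuousAt_snd
      have hcx : ContinuousAt (fun q : ℝ × ℝ => 4 * q.1 ^ 2) (x, m) := by fun_prop
      exact (continuousAt_snd.eventually (Ioo_mem_nhds hm.1 hm.2)).and
        (hcx.eventually_lt hcD hlt)
    have : Filter.map (Prod.map id s) (nhds x ×ˢ nhds m) =
        nhds x ×ˢ Filter.map s (nhds m) := by
      rw [← Filter.prod_map_map_eq', Filter.map_id]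
    rw [← this, Filter.mem_map]
    filter_upwards [hev] with q hq
    exact ⟨q.2, Ioo_subset_Icc_self hq.1, rfl, hq.2.le⟩
  refine ⟨hcomp, hconv, ?_, ?_⟩
  · have hmid : (a + b) / 2 ∈ Ioo a b := ⟨by linarith, by linarith⟩
    exact ⟨(0, s ((a + b) / 2)), hint 0 _ hmid (by simpa using hpos _ hmid)⟩
  · rw [hcomp.isClosed.frontier_eq]
    ext ⟨x, y⟩
    constructor
    · rintro ⟨⟨m, hm, hy, hx⟩, hni⟩
      refine ⟨m, hm, hy, hx.antisymm (not_lt.1 fun hlt => hni ?_)⟩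
      simp only at hy hlt
      have hma : m ≠ a := by
        rintro rfl
        nlinarith [sq_nonneg x]
      have hmb : m ≠ b := by
        rintro rfl
        nlinarith [sq_nonneg x]
      rw [hy]
      exact hint x m ⟨lt_of_le_of_ne hm.1 hma.symm, lt_of_le_of_ne hm.2 hmb⟩ hlt
    · rintro ⟨m, hm, hy, hx⟩
      refine ⟨⟨m, hm, hy, hx.le⟩, fun hi => ?_⟩
      rw [mem_interior_iff_mem_nhds] at hi
      simp only at hy hx
      have hout : ∀ x', (x', y) ∈ K → x' ^ 2 ≤ x ^ 2 := by
        rintro x' ⟨m', hm', hy', hx'⟩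
        simp only at hy' hx'
        rw [hinjOn hm' hm (hy'.symm.trans hy)] at hx'
        linarith
      have hnear : ∀ᶠ t in nhds (0 : ℝ), (x + t, y) ∈ K := by
        have hc : ContinuousAt (fun t : ℝ => (x + t, y)) 0 := by fun_prop
        refine hc.eventually_mem ?_
        simpa using hi
      obtain ⟨r, hr, hball⟩ := Metric.eventually_nhds_iff.1 hnear
      have h1 := hout _ (hball (y := r / 2) (by simp [abs_of_pos hr, hr]))
      have h2 := hout _ (hball (y := -(r / 2)) (by simp [abs_of_pos hr, hr]))
      nlinarith

/-- The partial derivative with respect to the first variable. -/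
noncomputable def partialFst (F : ℝ × ℝ → ℝ) (p : ℝ × ℝ) : ℝ := fderiv ℝ F p (1, 0)

lemma AnalyticAt.partialFst {F : ℝ × ℝ → ℝ} {p : ℝ × ℝ} (hF : AnalyticAt ℝ F p) :
    AnalyticAt ℝ (partialFst F) p :=
  ((ContinuousLinearMap.apply ℝ ℝ ((1, 0) : ℝ × ℝ)).analyticAt _).comp hF.fderiv

lemma AnalyticAt.hasStrictDerivAt_partialFst {F : ℝ × ℝ → ℝ} {x e : ℝ}
    (hF : AnalyticAt ℝ F (x, e)) :
    HasStrictDerivAt (fun m => F (m, e)) (_root_.partialFst F (x, e)) x :=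
  HasStrictFDerivAt.comp_hasStrictDerivAt (f := fun m : ℝ => (m, e)) x hF.hasStrictFDerivAt
    ((hasStrictDerivAt_id x).prodMk (hasStrictDerivAt_const x e))

lemma hasDerivAt_of_abs_sub_le_sq {f : ℝ → ℝ} {x k c d : ℝ} (hd : 0 < d)
    (h : ∀ t, |t| < d → |f (x + t) - (f x + k * t)| ≤ c * t ^ 2) : HasDerivAt f k x := by
  rw [hasDerivAt_iff_isLittleO_nhds_zero]
  refine Asymptotics.IsBigO.trans_isLittleO (g := fun t : ℝ => t ^ 2) ?_
    (Asymptotics.isLittleO_pow_id one_lt_two)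
  refine Asymptotics.IsBigO.of_bound c ?_
  filter_upwards [Metric.ball_mem_nhds (0 : ℝ) hd] with t ht
  have := h t (by simpa using ht)
  rw [Real.norm_eq_abs, Real.norm_eq_abs, abs_of_nonneg (sq_nonneg t), smul_eq_mul]
  convert this using 2
  ring

lemma abs_le_mul_sq_of_abs_add_le {T₁ T₂ C δ ε : ℝ} (hT₁ : 0 < T₁) (hC : 0 < C)
    (hδC : |δ| * (6 * C) < T₁) (hε : 0 < ε) (hε1 : ε < 1)
    (hεC : ε * (6 * C) < T₁)
    (h : |T₁ * δ + T₂ * ε ^ 2| ≤ C * (ε ^ 3 + |δ| * ε ^ 2 + |δ| ^ 2 * ε + |δ| ^ 2)) :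
    |δ| ≤ 2 * (|T₂| + C) / T₁ * ε ^ 2 := by
  have e1 : T₁ * |δ| ≤ |T₁ * δ + T₂ * ε ^ 2| + |T₂| * ε ^ 2 := by
    have := abs_sub (T₁ * δ + T₂ * ε ^ 2) (T₂ * ε ^ 2)
    rwa [add_sub_cancel_right, abs_mul, abs_mul, abs_of_pos hT₁, abs_of_nonneg (sq_nonneg ε)]
      at this
  have hA0 : 0 ≤ |δ| := abs_nonneg δ
  generalize |δ| = A at *
  have hAC : C * A ≤ T₁ / 6 := by linarith
  have hCε : C * ε ≤ T₁ / 6 := by linarith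
  have e2 : C * ε ^ 3 ≤ C * ε ^ 2 := by
    gcongr C * ?_
    exact pow_le_pow_of_le_one hε.le hε1.le (by norm_num)
  have e3 : C * (A * ε ^ 2) ≤ T₁ / 6 * A := by
    calc C * (A * ε ^ 2) = C * ε * A * ε := by ring
      _ ≤ T₁ / 6 * A * 1 := by gcongr
      _ = _ := by ring
  have e4 : C * (A ^ 2 * ε) ≤ T₁ / 6 * A := by
    calc C * (A ^ 2 * ε) = C * A * A * ε := by ring
      _ ≤ T₁ / 6 * A * 1 := by gcongr
      _ = _ := by ring
  have e5 : C * A ^ 2 ≤ T₁ / 6 * A := by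
    calc C * A ^ 2 = C * A * A := by ring
      _ ≤ T₁ / 6 * A := by gcongr
  rw [div_mul_eq_mul_div, le_div_iff₀ hT₁]
  linarith

/-- Near the origin `T₁ δ + T₂ ε² + h.o.t.` and `β₂ δ ε² + β₃ ε⁴ + h.o.t.` have no common zero
with `ε > 0`. -/
lemma exists_no_common_zero {T₁ T₂ β₂ β₃ C : ℝ} (hT₁ : 0 < T₁) (hC : 0 < C)
    (hK : β₃ - β₂ * T₂ / T₁ ≠ 0) :
    ∃ r > 0, ∀ δ ε : ℝ, |δ| < r → 0 < ε → ε < r →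
      |T₁ * δ + T₂ * ε ^ 2| ≤ C * (ε ^ 3 + |δ| * ε ^ 2 + δ ^ 2 * ε + δ ^ 2) →
      |β₂ * δ * ε ^ 2 + β₃ * ε ^ 4| ≤
        C * (ε ^ 5 + |δ| * ε ^ 3 + δ ^ 2 * ε ^ 2 + |δ| ^ 3 * ε) → False := by
  set M := 2 * (|T₂| + C) / T₁ with hM
  have hM0 : 0 ≤ M := by positivity
  set N := C * (1 + M + M ^ 2 + M ^ 2) with hN
  set P := C * (1 + M + M ^ 2 + M ^ 3) with hP
  set k := β₃ - β₂ * T₂ / T₁ with hk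
  have hk0 : 0 < |k| := abs_pos.2 hK
  set Q := |β₂| * N / T₁ + P + 1 with hQ
  have hN0 : 0 ≤ N := by positivity
  have hP0 : 0 ≤ P := by positivity
  have hQ0 : 0 < Q := by positivity
  refine ⟨min (min 1 (T₁ / (6 * C))) (|k| / Q), by positivity, ?_⟩
  intro δ ε hδ hε hεr h1 h2
  simp only [lt_min_iff] at hδ hεr
  obtain ⟨⟨-, hδC⟩, -⟩ := hδ
  obtain ⟨⟨hε1, hεC⟩, hεk⟩ := hεr
  rw [lt_div_iff₀ (by positivity)] at hδC hεC hεk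
  set A := |δ| with hA
  have hA0 : 0 ≤ A := abs_nonneg δ
  have hsq : δ ^ 2 = A ^ 2 := (sq_abs δ).symm
  rw [hsq] at h1 h2
  have hδle : A ≤ M * ε ^ 2 :=
    abs_le_mul_sq_of_abs_add_le hT₁ hC hδC hε hε1 hεC h1
  have hδ2 : A ^ 2 ≤ M ^ 2 * ε ^ 4 := by
    calc A ^ 2 ≤ (M * ε ^ 2) ^ 2 := by gcongr
      _ = _ := by ring
  have hδ3 : A ^ 3 ≤ M ^ 3 * ε ^ 6 := by
    calc A ^ 3 ≤ (M * ε ^ 2) ^ 3 := by gcongr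
      _ = _ := by ring
  have hpow : ∀ m n : ℕ, n ≤ m → ε ^ m ≤ ε ^ n := fun m n h =>
    pow_le_pow_of_le_one hε.le hε1.le h
  clear_value A
  have hT : |T₁ * δ + T₂ * ε ^ 2| ≤ N * ε ^ 3 := by
    refine h1.trans ?_
    rw [hN, mul_assoc]
    gcongr C * ?_
    have f1 : A * ε ^ 2 ≤ M * ε ^ 3 := by
      calc A * ε ^ 2 ≤ M * ε ^ 2 * ε ^ 2 := by gcongr
        _ = M * ε ^ 4 := by ring
        _ ≤ M * ε ^ 3 := by gcongr M * ?_; exact hpow 4 3 (by norm_num)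
    have f2 : A ^ 2 * ε ≤ M ^ 2 * ε ^ 3 := by
      calc A ^ 2 * ε ≤ M ^ 2 * ε ^ 4 * ε := by gcongr
        _ = M ^ 2 * ε ^ 5 := by ring
        _ ≤ M ^ 2 * ε ^ 3 := by gcongr M ^ 2 * ?_; exact hpow 5 3 (by norm_num)
    have f3 : A ^ 2 ≤ M ^ 2 * ε ^ 3 :=
      hδ2.trans (by gcongr M ^ 2 * ?_; exact hpow 4 3 (by norm_num))
    linarith
  have hB : |β₂ * δ * ε ^ 2 + β₃ * ε ^ 4| ≤ P * ε ^ 5 := by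
    refine h2.trans ?_
    rw [hP, mul_assoc]
    gcongr C * ?_
    have f1 : A * ε ^ 3 ≤ M * ε ^ 5 := by
      calc A * ε ^ 3 ≤ M * ε ^ 2 * ε ^ 3 := by gcongr
        _ = M * ε ^ 5 := by ring
    have f2 : A ^ 2 * ε ^ 2 ≤ M ^ 2 * ε ^ 5 := by
      calc A ^ 2 * ε ^ 2 ≤ M ^ 2 * ε ^ 4 * ε ^ 2 := by gcongr
        _ = M ^ 2 * ε ^ 6 := by ring
        _ ≤ M ^ 2 * ε ^ 5 := by gcongr M ^ 2 * ?_; exact hpow 6 5 (by norm_num)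
    have f3 : A ^ 3 * ε ≤ M ^ 3 * ε ^ 5 := by
      calc A ^ 3 * ε ≤ M ^ 3 * ε ^ 6 * ε := by gcongr
        _ = M ^ 3 * ε ^ 7 := by ring
        _ ≤ M ^ 3 * ε ^ 5 := by gcongr M ^ 3 * ?_; exact hpow 7 5 (by norm_num)
    linarith
  have hid : k * ε ^ 4 = (β₂ * δ * ε ^ 2 + β₃ * ε ^ 4) -
      β₂ / T₁ * ε ^ 2 * (T₁ * δ + T₂ * ε ^ 2) := by
    rw [hk]
    field_simp
    ring
  have hfin : |k| * ε ^ 4 ≤ P * ε ^ 5 + |β₂| / T₁ * ε ^ 2 * (N * ε ^ 3) := by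
    calc |k| * ε ^ 4 = |k * ε ^ 4| := by rw [abs_mul, abs_of_pos (pow_pos hε 4)]
      _ ≤ |β₂ * δ * ε ^ 2 + β₃ * ε ^ 4| + |β₂ / T₁ * ε ^ 2 * (T₁ * δ + T₂ * ε ^ 2)| := by
        rw [hid]
        exact abs_sub _ _
      _ ≤ _ := by
        rw [abs_mul (β₂ / T₁ * ε ^ 2), abs_mul (β₂ / T₁), abs_div, abs_of_pos hT₁,
          abs_of_nonneg (sq_nonneg ε)]
        gcongr
  have hε4 : 0 < ε ^ 4 := pow_pos hε 4
  have hle : |k| * ε ^ 4 ≤ (ε * Q - ε) * ε ^ 4 := by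
    refine hfin.trans (le_of_eq ?_)
    rw [hQ]
    ring
  linarith [le_of_mul_le_mul_right hle hε4]

lemma partialFst_of_eventually_eq_neg_sq {D T : ℝ × ℝ → ℝ} {x e : ℝ}
    (hD : AnalyticAt ℝ D (x, e)) (hT : AnalyticAt ℝ T (x, e))
    (h : ∀ᶠ m in nhds x, D (m, e) = -T (m, e) ^ 2) (hT0 : T (x, e) = 0) :
    partialFst D (x, e) = 0 ∧
      partialFst (partialFst D) (x, e) = -2 * partialFst T (x, e) ^ 2 := by
  have hc : ContinuousAt (fun m : ℝ => (m, e)) x := by fun_prop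
  have hfirst : ∀ᶠ m in nhds x,
      partialFst D (m, e) = -(2 * T (m, e) * partialFst T (m, e)) := by
    filter_upwards [h.eventually_nhds, hc.eventually hD.eventually_analyticAt,
      hc.eventually hT.eventually_analyticAt] with m hm hDm hTm
    have h1 := hDm.hasStrictDerivAt_partialFst.hasDerivAt
    have h2 := (hTm.hasStrictDerivAt_partialFst.hasDerivAt.pow 2).neg
    have h3 := h1.unique (h2.congr_of_eventuallyEq hm)
    simpa using h3
  refine ⟨by rw [hfirst.self_of_nhds, hT0]; simp, ?_⟩
  have h1 := hD.partialFst.hasStrictDerivAt_partialFst.hasDerivAt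
  have h2 := ((hT.hasStrictDerivAt_partialFst.hasDerivAt.const_mul 2).mul
    hT.partialFst.hasStrictDerivAt_partialFst.hasDerivAt).neg
  have h3 := h1.unique (h2.congr_of_eventuallyEq hfirst)
  rw [h3, hT0]
  ring

lemma exists_ratio_nonpos {S D : ℝ × ℝ → ℝ} {x e : ℝ} (hS : AnalyticAt ℝ S (x, e))
    (hD : AnalyticAt ℝ D (x, e)) (hS1 : partialFst S (x, e) ≠ 0)
    (hD1 : partialFst D (x, e) = 0) (hD2 : partialFst (partialFst D) (x, e) < 0) :
    ∃ r > 0, ∀ ε m : ℝ, |ε - e| < r → |m - x| < r →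
      AnalyticAt ℝ S (m, ε) ∧ AnalyticAt ℝ D (m, ε) ∧ partialFst S (m, ε) ≠ 0 ∧
      ∀ c, |c - x| < r → partialFst (partialFst D) (m, ε) -
        partialFst D (c, ε) / partialFst S (c, ε) * partialFst (partialFst S) (m, ε) ≤ 0 := by
  have h1 := (hS.eventually_analyticAt.and hD.eventually_analyticAt).and
    (hS.partialFst.continuousAt.eventually_ne hS1)
  have h2 : ∀ᶠ q : (ℝ × ℝ) × (ℝ × ℝ) in nhds ((x, e), (x, e)),
      partialFst (partialFst D) q.1 -
        partialFst D q.2 / partialFst S q.2 * partialFst (partialFst S) q.1 < 0 := by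
    have a1 : ContinuousAt (fun q : (ℝ × ℝ) × (ℝ × ℝ) => partialFst (partialFst D) q.1)
        ((x, e), (x, e)) :=
      ContinuousAt.comp (g := partialFst (partialFst D)) (x := ((x, e), (x, e)))
        hD.partialFst.partialFst.continuousAt continuousAt_fst
    have a2 : ContinuousAt (fun q : (ℝ × ℝ) × (ℝ × ℝ) => partialFst (partialFst S) q.1)
        ((x, e), (x, e)) :=
      ContinuousAt.comp (g := partialFst (partialFst S)) (x := ((x, e), (x, e)))
        hS.partialFst.partialFst.continuousAt continuousAt_fst
    have a3 : ContinuousAt (fun q : (ℝ × ℝ) × (ℝ × ℝ) => partialFst D q.2)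
        ((x, e), (x, e)) :=
      ContinuousAt.comp (g := partialFst D) (x := ((x, e), (x, e)))
        hD.partialFst.continuousAt continuousAt_snd
    have a4 : ContinuousAt (fun q : (ℝ × ℝ) × (ℝ × ℝ) => partialFst S q.2)
        ((x, e), (x, e)) :=
      ContinuousAt.comp (g := partialFst S) (x := ((x, e), (x, e)))
        hS.partialFst.continuousAt continuousAt_snd
    refine (a1.sub ((a3.div a4 hS1).mul a2)).eventually_lt continuousAt_const ?_
    simpa [hD1] using hD2
  obtain ⟨r₁, hr₁, H₁⟩ := Metric.eventually_nhds_iff.1 h1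
  obtain ⟨r₂, hr₂, H₂⟩ := Metric.eventually_nhds_iff.1 h2
  refine ⟨min r₁ r₂, lt_min hr₁ hr₂, fun ε m hε hm => ?_⟩
  rw [lt_min_iff] at hε hm
  obtain ⟨⟨hSm, hDm⟩, hne⟩ := H₁ (y := (m, ε)) (by
    rw [Prod.dist_eq, Real.dist_eq, Real.dist_eq]
    exact max_lt hm.1 hε.1)
  refine ⟨hSm, hDm, hne, fun c hc => ?_⟩
  rw [lt_min_iff] at hc
  refine (H₂ (y := ((m, ε), (c, ε))) ?_).le
  simp only [Prod.dist_eq, Real.dist_eq]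
  exact max_lt (max_lt hm.2 hε.2) (max_lt hc.2 hε.2)

lemma AssumptionH.values_zero {μb ωs δ₀ ε₀ : ℝ} {α β γ : ℝ → ℝ → ℝ}
    {α₁ α₂ β₁ β₂ β₃ γ₁ γ₂ : ℝ}
    (hH : AssumptionH μb ωs δ₀ ε₀ α β γ α₁ α₂ β₁ β₂ β₃ γ₁ γ₂) :
    α μb 0 = -ωs ∧ γ μb 0 = ωs ∧ β μb 0 = 0 ∧ ∃ d > 0, ∃ C, ∀ δ, |δ| < d →
      |α (μb + δ) 0 - (α μb 0 + α₁ * δ)| ≤ C * δ ^ 2 ∧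
      |γ (μb + δ) 0 - (γ μb 0 + γ₁ * δ)| ≤ C * δ ^ 2 ∧ β (μb + δ) 0 = 0 := by
  obtain ⟨α₀, γ₀, d, hd, e, he, C, -, -, -, hexp⟩ := hH.hexp
  have hαγβ0 : ∀ δ, |δ| < d → α (μb + δ) 0 = -α₀ δ ∧ γ (μb + δ) 0 = γ₀ δ ∧
      β (μb + δ) 0 = 0 := by
    intro δ hδ
    obtain ⟨h1, h2, h3, -, -⟩ := hexp δ 0 hδ (by simpa using he.1)
    simp only [abs_zero, ne_eq, OfNat.ofNat_ne_zero, not_false_eq_true, zero_pow, mul_zero,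
      add_zero, abs_nonpos_iff, sub_eq_zero, sub_zero] at h1 h2 h3
    exact ⟨h1, h3, h2⟩
  have h0 : α₀ 0 = ωs ∧ γ₀ 0 = ωs := by
    obtain ⟨-, -, -, h4, h5⟩ := hexp 0 0 (by simpa using hd.1) (by simpa using he.1)
    simp only [ne_eq, OfNat.ofNat_ne_zero, not_false_eq_true, zero_pow, mul_zero,
      add_zero, abs_nonpos_iff, sub_eq_zero, sub_zero] at h4 h5
    exact ⟨h4, h5⟩
  have hb0 := hαγβ0 0 (by simpa using hd.1)
  rw [add_zero, h0.1, h0.2] at hb0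
  obtain ⟨hα0, hγ0, hβ0⟩ := hb0
  refine ⟨hα0, hγ0, hβ0, d, hd.1, C, fun δ hδ => ?_⟩
  obtain ⟨-, -, -, h4, h5⟩ := hexp δ 0 hδ (by simpa using he.1)
  obtain ⟨e1, e2, e3⟩ := hαγβ0 δ hδ
  rw [e1, e2, hα0, hγ0]
  refine ⟨?_, h5, e3⟩
  rw [← abs_neg]
  convert h4 using 2
  ring

lemma ZeroCurves.tendsto {μb ωs δ₀ ε₀ : ℝ} {α β γ : ℝ → ℝ → ℝ}
    {α₁ α₂ β₁ β₂ β₃ γ₁ γ₂ : ℝ}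
    (hH : AssumptionH μb ωs δ₀ ε₀ α β γ α₁ α₂ β₁ β₂ β₃ γ₁ γ₂)
    {ε₁ : ℝ} (hε₁ : 0 < ε₁) {μ₀ μp μm : ℝ → ℝ} (hZ : ZeroCurves μb δ₀ α β γ ε₁ μ₀ μp μm)
    {R : ℝ} (hR0 : 0 < R) :
    ∃ q > 0, ∀ ε, |ε| < q → |μp ε - μb| < R ∧ |μm ε - μb| < R := by
  obtain ⟨hα0, hγ0, hβ0, -⟩ := hH.values_zero
  have hmem : μb ∈ Ioo (μb - δ₀) (μb + δ₀) := ⟨by linarith [hH.hδ₀], by linarith [hH.hδ₀]⟩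
  have h0mem : (0 : ℝ) ∈ Ioo (-ε₁) ε₁ := ⟨by linarith, hε₁⟩
  have hμp0 : μp 0 = μb :=
    ((hZ.hdp μb hmem 0 h0mem).1.1 (by rw [hα0, hγ0, hβ0]; ring)).symm
  have hμm0 : μm 0 = μb :=
    ((hZ.hdm μb hmem 0 h0mem).1.1 (by rw [hα0, hγ0, hβ0]; ring)).symm
  have hp := (hZ.hμp_an 0 h0mem).continuousAt.eventually (Metric.ball_mem_nhds _ hR0)
  have hm := (hZ.hμm_an 0 h0mem).continuousAt.eventually (Metric.ball_mem_nhds _ hR0)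
  rw [hμp0] at hp
  rw [hμm0] at hm
  obtain ⟨q, hq, H⟩ := Metric.eventually_nhds_iff.1 (hp.and hm)
  exact ⟨q, hq, fun ε hε => by simpa [Real.dist_eq] using H (y := ε) (by simpa using hε)⟩

lemma ZeroCurves.exists_ne {μb ωs δ₀ ε₀ : ℝ} {α β γ : ℝ → ℝ → ℝ}
    {α₁ α₂ β₁ β₂ β₃ γ₁ γ₂ : ℝ}
    (hH : AssumptionH μb ωs δ₀ ε₀ α β γ α₁ α₂ β₁ β₂ β₃ γ₁ γ₂)
    (hβ₁ : β₁ = 0) (hK : β₃ - β₂ * (α₂ + γ₂) / (α₁ + γ₁) ≠ 0)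
    {ε₁ : ℝ} (hε₁ : 0 < ε₁) {μ₀ μp μm : ℝ → ℝ} (hZ : ZeroCurves μb δ₀ α β γ ε₁ μ₀ μp μm) :
    ∃ r > 0, ∀ ε, 0 < ε → ε < r → μp ε ≠ μm ε := by
  subst hβ₁
  obtain ⟨α₀, γ₀, d, hd, e, he, C, hC, -, -, hexp⟩ := hH.hexp
  obtain ⟨ρ, hρ, Hρ⟩ := exists_no_common_zero hH.hT₁ (by positivity : 0 < 2 * C) hK
  obtain ⟨q, hq, Hq⟩ := hZ.tendsto hH hε₁ (lt_min hρ hd.1)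
  refine ⟨min (min ε₁ q) (min ρ e),
    lt_min (lt_min hε₁ hq) (lt_min hρ he.1), fun ε hεpos hεlt heq => ?_⟩
  simp only [lt_min_iff] at hεlt
  obtain ⟨⟨hεε₁, hεq⟩, hερ, hεe⟩ := hεlt
  have hεabs : |ε| = ε := abs_of_pos hεpos
  have hεmem : ε ∈ Ioo (-ε₁) ε₁ := ⟨by linarith, hεε₁⟩
  obtain ⟨hpR, -⟩ := Hq ε (by rwa [hεabs])
  rw [lt_min_iff] at hpR
  have z1 := (hZ.hdp _ (hZ.hmapsp ε hεmem) ε hεmem).1.2 rfl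
  have z2 := (hZ.hdm _ (hZ.hmapsp ε hεmem) ε hεmem).1.2 heq
  obtain ⟨h1, h2, h3, h4, h5⟩ := hexp (μp ε - μb) ε hpR.2 (by rwa [hεabs])
  rw [add_sub_cancel] at h1 h2 h3
  have zT : α (μp ε) ε + γ (μp ε) ε = 0 := by linarith
  have zβ : β (μp ε) ε = 0 := by linarith
  rw [zβ, hεabs, zero_mul, zero_add, zero_sub, abs_neg] at h2
  rw [hεabs] at h1 h3
  refine Hρ (μp ε - μb) ε hpR.1 hεpos hερ ?_ (h2.trans ?_)
  · rw [abs_le] at *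
    constructor <;> linarith
  · have : 0 ≤ C * (ε ^ 5 + |μp ε - μb| * ε ^ 3 + (μp ε - μb) ^ 2 * ε ^ 2 +
        |μp ε - μb| ^ 3 * ε) := by positivity
    linarith

theorem stmt11 (μb ωs δ₀ ε₀ : ℝ) (α β γ : ℝ → ℝ → ℝ) (α₁ α₂ β₁ β₂ β₃ γ₁ γ₂ : ℝ)
    (hH : AssumptionH μb ωs δ₀ ε₀ α β γ α₁ α₂ β₁ β₂ β₃ γ₁ γ₂)
    (hβ₁ : β₁ = 0) (hK : β₃ - β₂ * (α₂ + γ₂) / (α₁ + γ₁) ≠ 0) (hαγ : α₁ ≠ γ₁)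
    (ε₁ : ℝ) (hε₁ : ε₁ ∈ Ioc (0 : ℝ) ε₀) (μ₀ μp μm : ℝ → ℝ)
    (hZ : ZeroCurves μb δ₀ α β γ ε₁ μ₀ μp μm) :
    ∃ ε₂ ∈ Ioc (0 : ℝ) ε₁, ∀ ε ∈ Ioo (0 : ℝ) ε₂,
      IsCompact {p : ℝ × ℝ | ∃ μ ∈ Icc (min (μp ε) (μm ε)) (max (μp ε) (μm ε)),
          p.2 = (γ μ ε - α μ ε) / 2 ∧
          4 * p.1 ^ 2 ≤ 4 * β μ ε ^ 2 - (α μ ε + γ μ ε) ^ 2} ∧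
      Convex ℝ {p : ℝ × ℝ | ∃ μ ∈ Icc (min (μp ε) (μm ε)) (max (μp ε) (μm ε)),
          p.2 = (γ μ ε - α μ ε) / 2 ∧
          4 * p.1 ^ 2 ≤ 4 * β μ ε ^ 2 - (α μ ε + γ μ ε) ^ 2} ∧
      (interior {p : ℝ × ℝ | ∃ μ ∈ Icc (min (μp ε) (μm ε)) (max (μp ε) (μm ε)),
          p.2 = (γ μ ε - α μ ε) / 2 ∧
          4 * p.1 ^ 2 ≤ 4 * β μ ε ^ 2 - (α μ ε + γ μ ε) ^ 2}).Nonempty ∧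
      frontier {p : ℝ × ℝ | ∃ μ ∈ Icc (min (μp ε) (μm ε)) (max (μp ε) (μm ε)),
          p.2 = (γ μ ε - α μ ε) / 2 ∧
          4 * p.1 ^ 2 ≤ 4 * β μ ε ^ 2 - (α μ ε + γ μ ε) ^ 2} =
        {p : ℝ × ℝ | ∃ μ ∈ Icc (min (μp ε) (μm ε)) (max (μp ε) (μm ε)), ∃ l : ℂ,
          IsEig (Lmat (α μ ε) (β μ ε) (γ μ ε)) l ∧ p = (l.re, l.im)} := by
  obtain ⟨hδ₀, hε₀, hα_an, hβ_an, hγ_an, hT₁, -⟩ := id hH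
  obtain ⟨-, -, -, -, hmapsp, hmapsm, -, hdp, hdm⟩ := id hZ
  obtain ⟨hα0, hγ0, hβ0, d, hd, C, hexp⟩ := hH.values_zero
  set S : ℝ × ℝ → ℝ := fun p => (γ p.1 p.2 - α p.1 p.2) / 2 with hSdef
  set T : ℝ × ℝ → ℝ := fun p => α p.1 p.2 + γ p.1 p.2 with hTdef
  set D : ℝ × ℝ → ℝ := fun p => 4 * β p.1 p.2 ^ 2 - (α p.1 p.2 + γ p.1 p.2) ^ 2 with hDdef
  have hbase : ((μb, 0) : ℝ × ℝ) ∈ Ioo (μb - δ₀) (μb + δ₀) ×ˢ Ioo (-ε₀) ε₀ :=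
    ⟨⟨by linarith, by linarith⟩, ⟨by linarith, by linarith⟩⟩
  have hSb : AnalyticAt ℝ S (μb, 0) :=
    ((hγ_an _ hbase).sub (hα_an _ hbase)).div_const
  have hTb : AnalyticAt ℝ T (μb, 0) := (hα_an _ hbase).add (hγ_an _ hbase)
  have hDb : AnalyticAt ℝ D (μb, 0) :=
    (analyticAt_const.mul ((hβ_an _ hbase).pow 2)).sub (hTb.pow 2)
  have hT0 : T (μb, 0) = 0 := by simp [hTdef, hα0, hγ0]
  have hTder : partialFst T (μb, 0) = α₁ + γ₁ := by
    refine hTb.hasStrictDerivAt_partialFst.hasDerivAt.unique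
      (hasDerivAt_of_abs_sub_le_sq hd (c := 2 * C) fun t ht => ?_)
    obtain ⟨h4, h5, -⟩ := hexp t ht
    simp only [hTdef]
    rw [abs_le] at *
    constructor <;> linarith
  have hSder : partialFst S (μb, 0) = (γ₁ - α₁) / 2 := by
    refine hSb.hasStrictDerivAt_partialFst.hasDerivAt.unique
      (hasDerivAt_of_abs_sub_le_sq hd (c := C) fun t ht => ?_)
    obtain ⟨h4, h5, -⟩ := hexp t ht
    simp only [hSdef]
    rw [abs_le] at *
    constructor <;> linarith
  have hDT : ∀ᶠ m in nhds μb, D (m, 0) = -T (m, 0) ^ 2 := by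
    filter_upwards [Metric.ball_mem_nhds μb hd] with m hm
    have := (hexp (m - μb) (by simpa [Real.dist_eq] using hm)).2.2
    rw [add_sub_cancel] at this
    simp [hDdef, hTdef, this]
  obtain ⟨hD1, hD2⟩ := partialFst_of_eventually_eq_neg_sq hDb hTb hDT hT0
  rw [hTder] at hD2
  obtain ⟨r, hr, Hr⟩ := exists_ratio_nonpos hSb hDb
    (by rw [hSder]; exact div_ne_zero (sub_ne_zero.2 hαγ.symm) two_ne_zero) hD1
    (by rw [hD2]; nlinarith)
  obtain ⟨ρ, hρ, Hρ⟩ := hZ.exists_ne hH hβ₁ hK hε₁.1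
  obtain ⟨q, hq, Hq⟩ := hZ.tendsto hH hε₁.1 hr
  refine ⟨min (min ε₁ r) (min ρ q),
    ⟨lt_min (lt_min hε₁.1 hr) (lt_min hρ hq),
      (min_le_left _ _).trans (min_le_left _ _)⟩, fun ε hε => ?_⟩
  obtain ⟨hεpos, hεlt⟩ := hε
  simp only [lt_min_iff] at hεlt
  obtain ⟨⟨hεε₁, hεr⟩, hερ, hεq⟩ := hεlt
  have hεabs : |ε| = ε := abs_of_pos hεpos
  have hεmem : ε ∈ Ioo (-ε₁) ε₁ := ⟨by linarith, hεε₁⟩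
  obtain ⟨hpR, hmR⟩ := Hq ε (by rwa [hεabs])
  have hne := Hρ ε hεpos hερ
  set a := min (μp ε) (μm ε) with ha
  set b := max (μp ε) (μm ε) with hb
  have hab : a < b := min_lt_max.2 hne
  have hIoo : Icc a b ⊆ Ioo (μb - δ₀) (μb + δ₀) := by
    rintro x ⟨hx1, hx2⟩
    exact ⟨(lt_min (hmapsp ε hεmem).1 (hmapsm ε hεmem).1).trans_le hx1,
      hx2.trans_lt (max_lt (hmapsp ε hεmem).2 (hmapsm ε hεmem).2)⟩
  have hnear : ∀ x ∈ Icc a b, |x - μb| < r := by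
    rintro x ⟨hx1, hx2⟩
    rw [abs_lt] at *
    have h1 : μb - r < a := lt_min (by linarith) (by linarith)
    have h2 : b < μb + r := max_lt (by linarith) (by linarith)
    constructor <;> linarith
  have hrε : |ε - 0| < r := by rwa [sub_zero, hεabs]
  have hDp : D (μp ε, ε) = 0 := by
    have := (hdp _ (hmapsp ε hεmem) ε hεmem).1.2 rfl
    simp only [hDdef]
    linear_combination (2 * β (μp ε) ε - (α (μp ε) ε + γ (μp ε) ε)) * this
  have hDm : D (μm ε, ε) = 0 := by
    have := (hdm _ (hmapsm ε hεmem) ε hεmem).1.2 rfl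
    simp only [hDdef]
    linear_combination (-2 * β (μm ε) ε - (α (μm ε) ε + γ (μm ε) ε)) * this
  have hDa : D (a, ε) = 0 := by
    rcases min_choice (μp ε) (μm ε) with h | h <;> rw [ha, h] <;> assumption
  have hDb' : D (b, ε) = 0 := by
    rcases max_choice (μp ε) (μm ε) with h | h <;> rw [hb, h] <;> assumption
  have hDpos : ∀ x ∈ Ioo a b, 0 < D (x, ε) := by
    intro x hx
    have hx' := hIoo (Ioo_subset_Icc_self hx)
    have hfac : D (x, ε) = (α x ε + γ x ε + 2 * β x ε) * -(α x ε + γ x ε - 2 * β x ε) := by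
      simp only [hDdef]
      ring
    rw [hfac]
    obtain ⟨-, p1, p2⟩ := hdp x hx' ε hεmem
    obtain ⟨-, m1, m2⟩ := hdm x hx' ε hεmem
    rcases lt_or_gt_of_ne hne with h | h
    · rw [ha, hb, min_eq_left h.le, max_eq_right h.le] at hx
      exact mul_pos (p1 hx.1) (neg_pos.2 (m2 hx.2))
    · rw [ha, hb, min_eq_right h.le, max_eq_left h.le] at hx
      exact mul_pos_of_neg_of_neg (p2 hx.2) (neg_lt_zero.2 (m1 hx.1))
  have hDnonneg : ∀ x ∈ Icc a b, 0 ≤ D (x, ε) := by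
    intro x hx
    rcases eq_endpoints_or_mem_Ioo_of_mem_Icc hx with rfl | rfl | h
    · exact hDa.ge
    · exact hDb'.ge
    · exact (hDpos x h).le
  obtain ⟨c1, c2, c3, c4⟩ := convexBody_of_ratio hab
    (s := fun x => S (x, ε)) (D := fun x => D (x, ε))
    (fun x hx => (Hr ε x hrε (hnear x hx)).1.hasStrictDerivAt_partialFst)
    (fun x hx => (Hr ε x hrε (hnear x hx)).1.partialFst.hasStrictDerivAt_partialFst.hasDerivAt)
    (fun x hx => (Hr ε x hrε (hnear x hx)).2.1.hasStrictDerivAt_partialFst.hasDerivAt)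
    (fun x hx =>
      (Hr ε x hrε (hnear x hx)).2.1.partialFst.hasStrictDerivAt_partialFst.hasDerivAt)
    (fun x hx => (Hr ε x hrε (hnear x hx)).2.2.1)
    (fun c hc x hx => (Hr ε x hrε (hnear x hx)).2.2.2 c (hnear c hc))
    hDa hDb' hDpos
  refine ⟨c1, c2, c3, c4.trans ?_⟩
  ext ⟨x, y⟩
  refine exists_congr fun m => and_congr_right fun hm => ?_
  have hiff := isEig_Lmat_iff (α m ε) (β m ε) (γ m ε) (hDnonneg m hm)
  constructor
  · rintro ⟨hy, hx⟩
    exact ⟨⟨x, y⟩, (hiff _).2 ⟨hy, hx⟩, rfl⟩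
  · rintro ⟨l, hl, heq⟩
    obtain ⟨rfl, rfl⟩ := Prod.mk.injEq _ _ _ _ ▸ heq
    exact (hiff l).1 hl
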